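/- Let A = M₂(𝔽) with 𝔽 ∈ {ℝ, ℂ, ℍ}, endowed with the operator norm, let tr denote the normalized trace (tr(1) = 1), and let H := {a ∈ A : a* = a, tr(a) = 0} be the space of traceless self-adjoint elements. Then H is a real Hilbert space with norm ‖b‖ = tr(b*b)^{1/2} (equal to the operator norm on H), and the map a ↦ (tr(a), a − tr(a)·1) is an isometric isomorphism from the self-adjoint part A_sa onto the ℓ¹-direct sum ℝ ⊕₁ H; equivalently, ‖a‖ = |tr(a)| + ‖a − tr(a)1‖ for every self-adjoint a ∈ A. Moreover, if x ∈ S_A satisfies ‖1 + x‖ = 2 and ‖1 − x‖ = 2, then x ∈ H. -/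

import Mathlib

open Matrix

/-- The operator norm of a `2 × 2` matrix over `𝔽 ∈ {ℝ, ℂ, ℍ}`, acting on the Hilbert
`𝔽`-module `𝔽²` (with the Euclidean norm). -/
noncomputable def opN (𝔽 : Type*) [NormedDivisionRing 𝔽]
    (a : Matrix (Fin 2) (Fin 2) 𝔽) : ℝ :=
  sSup {r : ℝ | ∃ v : Fin 2 → 𝔽, ‖v 0‖ ^ 2 + ‖v 1‖ ^ 2 ≤ 1 ∧
    r = Real.sqrt (‖a.mulVec v 0‖ ^ 2 + ‖a.mulVec v 1‖ ^ 2)}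

/-- The statement of the lemma for `A = M₂(𝔽)` with normalized trace `tr` (`tr 1 = 1`) and
`H = {a : a* = a, tr a = 0}`:
(i) on `H`, the operator norm equals the Hilbert space norm `tr(b* b) ^ (1/2)`;
(ii) `H` satisfies the parallelogram law, so it is a real Hilbert space;
(iii) `‖a‖ = |tr a| + ‖a - (tr a) • 1‖` for self-adjoint `a`, i.e. `A_sa ≅ ℝ ⊕₁ H`
isometrically via `a ↦ (tr a, a - (tr a) • 1)`;
(iv) if `x ∈ S_A` satisfies `‖1 + x‖ = 2 = ‖1 - x‖`, then `x ∈ H`. -/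
def TracelessSelfAdjointL1Decomposition (𝔽 : Type*) [NormedDivisionRing 𝔽] [StarRing 𝔽] :
    Prop :=
  (∀ b : Matrix (Fin 2) (Fin 2) 𝔽, bᴴ = b → Matrix.trace b = 0 →
      opN 𝔽 b = Real.sqrt (‖Matrix.trace (bᴴ * b)‖ / 2)) ∧
  (∀ b c : Matrix (Fin 2) (Fin 2) 𝔽, bᴴ = b → Matrix.trace b = 0 →
      cᴴ = c → Matrix.trace c = 0 →
      opN 𝔽 (b + c) ^ 2 + opN 𝔽 (b - c) ^ 2 = 2 * opN 𝔽 b ^ 2 + 2 * opN 𝔽 c ^ 2) ∧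
  (∀ a : Matrix (Fin 2) (Fin 2) 𝔽, aᴴ = a →
      opN 𝔽 a = ‖Matrix.trace a‖ / 2 + opN 𝔽 (a - (Matrix.trace a / 2) • 1)) ∧
  (∀ x : Matrix (Fin 2) (Fin 2) 𝔽, opN 𝔽 x = 1 →
      opN 𝔽 (1 + x) = 2 → opN 𝔽 (1 - x) = 2 → xᴴ = x ∧ Matrix.trace x = 0)

/-- A finite-dimensional normed division `ℝ`-algebra with involution whose norm is given by
`star x * x = ‖x‖ ^ 2` and whose self-adjoint elements are the real scalars. -/
class RealStarDivisionAlgebra (𝔽 : Type*) [NormedDivisionRing 𝔽] [StarRing 𝔽]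
    [NormedAlgebra ℝ 𝔽] : Prop where
  finite : FiniteDimensional ℝ 𝔽
  star_mul_self_eq (x : 𝔽) : star x * x = algebraMap ℝ 𝔽 (‖x‖ ^ 2)
  exists_of_star_eq (x : 𝔽) : star x = x → ∃ r : ℝ, x = algebraMap ℝ 𝔽 r

attribute [instance] RealStarDivisionAlgebra.finite

instance : RealStarDivisionAlgebra ℝ where
  finite := inferInstance
  star_mul_self_eq x := by simp [sq]
  exists_of_star_eq x _ := ⟨x, rfl⟩

instance : RealStarDivisionAlgebra ℂ where
  finite := inferInstance
  star_mul_self_eq x := by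
    simpa using Complex.conj_mul' x
  exists_of_star_eq x hx := ⟨x.re, (Complex.conj_eq_iff_re.mp hx).symm⟩

instance : RealStarDivisionAlgebra (Quaternion ℝ) where
  finite := inferInstance
  star_mul_self_eq x := by
    rw [Quaternion.star_mul_self, Quaternion.normSq_eq_norm_mul_self, sq]
    rfl
  exists_of_star_eq x hx := ⟨x.re, Quaternion.star_eq_self.mp hx⟩

namespace RealStarDivisionAlgebra

/-- The Euclidean plane over `𝔽`. -/
abbrev Plane (𝔽 : Type*) := PiLp 2 fun _ : Fin 2 => 𝔽

theorem norm_sq_plane {𝔽 : Type*} [NormedDivisionRing 𝔽] (v : Plane 𝔽) :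
    ‖v‖ ^ 2 = ‖v 0‖ ^ 2 + ‖v 1‖ ^ 2 := by
  rw [PiLp.norm_sq_eq_of_L2, Fin.sum_univ_two]

variable {𝔽 : Type*} [NormedDivisionRing 𝔽] [StarRing 𝔽] [NormedAlgebra ℝ 𝔽]

/-- The self-adjoint matrix with diagonal `p, s` and upper corner `q`. -/
noncomputable def hermitian (p s : ℝ) (q : 𝔽) : Matrix (Fin 2) (Fin 2) 𝔽 :=
  !![algebraMap ℝ 𝔽 p, q; star q, algebraMap ℝ 𝔽 s]

theorem trace_hermitian (p s : ℝ) (q : 𝔽) :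
    trace (hermitian p s q) = algebraMap ℝ 𝔽 (p + s) := by
  simp [hermitian, trace_fin_two]

theorem half_trace_hermitian (p s : ℝ) (q : 𝔽) :
    trace (hermitian p s q) / 2 = algebraMap ℝ 𝔽 ((p + s) / 2) := by
  rw [trace_hermitian, map_div₀, map_ofNat]

theorem hermitian_eq_add (p s : ℝ) (q : 𝔽) :
    hermitian p s q = (trace (hermitian p s q) / 2) • (1 : Matrix (Fin 2) (Fin 2) 𝔽) +
      hermitian ((p - s) / 2) (-((p - s) / 2)) q := by
  rw [half_trace_hermitian]
  have hp : algebraMap ℝ 𝔽 p = algebraMap ℝ 𝔽 ((p + s) / 2) + algebraMap ℝ 𝔽 ((p - s) / 2) := by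
    rw [← map_add]
    ring_nf
  have hs : algebraMap ℝ 𝔽 s =
      algebraMap ℝ 𝔽 ((p + s) / 2) + algebraMap ℝ 𝔽 (-((p - s) / 2)) := by
    rw [← map_add]
    ring_nf
  ext i j
  fin_cases i <;> fin_cases j
  · rw [Matrix.add_apply, Matrix.smul_apply, one_apply_eq, smul_eq_mul, mul_one]
    exact hp
  · simp [hermitian]
  · simp [hermitian]
  · rw [Matrix.add_apply, Matrix.smul_apply, one_apply_eq, smul_eq_mul, mul_one]
    exact hs

variable [RealStarDivisionAlgebra 𝔽]

theorem self_mul_star_eq (x : 𝔽) : x * star x = algebraMap ℝ 𝔽 (‖x‖ ^ 2) := by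
  rcases eq_or_ne x 0 with rfl | hx
  · simp
  · apply mul_right_cancel₀ hx
    rw [mul_assoc, star_mul_self_eq, Algebra.commutes]

theorem star_algebraMap (r : ℝ) : star (algebraMap ℝ 𝔽 r) = algebraMap ℝ 𝔽 r := by
  have nonneg_case (s : ℝ) (hs : 0 ≤ s) :
      star (algebraMap ℝ 𝔽 s) = algebraMap ℝ 𝔽 s := by
    have h := star_mul_self_eq (algebraMap ℝ 𝔽 (√s))
    rw [norm_algebraMap', Real.norm_eq_abs, sq_abs, Real.sq_sqrt hs] at h
    rw [← h, star_mul, star_star]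
  rcases le_total 0 r with hr | hr
  · exact nonneg_case r hr
  · simpa using nonneg_case (-r) (by linarith)

theorem algebraMap_norm_sq_plane (v : Plane 𝔽) :
    algebraMap ℝ 𝔽 (‖v‖ ^ 2) = star v.ofLp ⬝ᵥ v.ofLp := by
  simp [norm_sq_plane, dotProduct, Fin.sum_univ_two, star_mul_self_eq]

theorem parallelogram (v w : 𝔽) :
    ‖v + w‖ ^ 2 + ‖v - w‖ ^ 2 = 2 * ‖v‖ ^ 2 + 2 * ‖w‖ ^ 2 := by
  apply FaithfulSMul.algebraMap_injective ℝ 𝔽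
  simp only [map_add, map_mul, map_ofNat, ← star_mul_self_eq, star_add, star_sub]
  noncomm_ring

theorem parallelogram_plane (v w : Plane 𝔽) :
    ‖v + w‖ ^ 2 + ‖v - w‖ ^ 2 = 2 * ‖v‖ ^ 2 + 2 * ‖w‖ ^ 2 := by
  simp only [norm_sq_plane, PiLp.add_apply, PiLp.sub_apply]
  linarith [parallelogram (v 0) (w 0), parallelogram (v 1) (w 1)]

/-- The real-linear operator on the Euclidean plane given by a matrix. -/
noncomputable def toOp (a : Matrix (Fin 2) (Fin 2) 𝔽) : Plane 𝔽 →L[ℝ] Plane 𝔽 :=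
  LinearMap.toContinuousLinearMap
    { toFun := fun v => WithLp.toLp 2 (a *ᵥ v.ofLp)
      map_add' := fun v w => by rw [WithLp.ofLp_add, mulVec_add, WithLp.toLp_add]
      map_smul' := fun r v => by
        rw [WithLp.ofLp_smul, mulVec_smul, WithLp.toLp_smul, RingHom.id_apply] }

theorem toOp_apply (a : Matrix (Fin 2) (Fin 2) 𝔽) (v : Plane 𝔽) :
    toOp a v = WithLp.toLp 2 (a *ᵥ v.ofLp) := rfl

theorem toOp_add (a b : Matrix (Fin 2) (Fin 2) 𝔽) : toOp (a + b) = toOp a + toOp b := by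
  ext1 v
  rw [_root_.add_apply, toOp_apply, add_mulVec, WithLp.toLp_add]
  rfl

theorem toOp_sub (a b : Matrix (Fin 2) (Fin 2) 𝔽) : toOp (a - b) = toOp a - toOp b := by
  ext1 v
  rw [_root_.sub_apply, toOp_apply, sub_mulVec, WithLp.toLp_sub]
  rfl

theorem toOp_algebraMap_smul_one (r : ℝ) :
    toOp (algebraMap ℝ 𝔽 r • (1 : Matrix (Fin 2) (Fin 2) 𝔽)) =
      r • ContinuousLinearMap.id ℝ (Plane 𝔽) := by
  ext1 v
  simp [toOp_apply, smul_mulVec]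

theorem toOp_one :
    toOp (1 : Matrix (Fin 2) (Fin 2) 𝔽) = ContinuousLinearMap.id ℝ (Plane 𝔽) := by
  ext1 v
  simp [toOp_apply]

theorem opN_eq_norm (a : Matrix (Fin 2) (Fin 2) 𝔽) : opN 𝔽 a = ‖toOp a‖ := by
  rw [← ContinuousLinearMap.sSup_unitClosedBall_eq_norm, opN]
  congr 1
  ext r
  simp only [Set.mem_ofPred_eq, Set.mem_image, Metric.mem_closedBall, dist_zero_right]
  constructor
  · rintro ⟨v, hv, rfl⟩
    refine ⟨WithLp.toLp 2 v, ?_, ?_⟩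
    · rw [← sq_le_one_iff₀ (norm_nonneg _), norm_sq_plane]
      exact hv
    · rw [← Real.sqrt_sq (norm_nonneg (toOp a (WithLp.toLp 2 v))), norm_sq_plane]
      rfl
  · rintro ⟨v, hv, rfl⟩
    refine ⟨v.ofLp, ?_, ?_⟩
    · rw [← norm_sq_plane]
      exact (sq_le_one_iff₀ (norm_nonneg _)).mpr hv
    · rw [← Real.sqrt_sq (norm_nonneg (toOp a v)), norm_sq_plane]
      rfl

theorem exists_norm_toOp_eq (a : Matrix (Fin 2) (Fin 2) 𝔽) :
    ∃ v : Plane 𝔽, ‖v‖ ≤ 1 ∧ ‖toOp a v‖ = opN 𝔽 a := by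
  have : ProperSpace (Plane 𝔽) := FiniteDimensional.proper_real _
  obtain ⟨v, hv, hmax⟩ := (isCompact_closedBall (0 : Plane 𝔽) 1).exists_isMaxOn
    ⟨0, by simp⟩ (toOp a).continuous.norm.continuousOn
  have hv' : ‖v‖ ≤ 1 := by simpa using hv
  refine ⟨v, hv', le_antisymm ?_ ?_⟩
  · rw [opN_eq_norm]
    simpa using (toOp a).le_opNorm_of_le hv'
  · rw [opN_eq_norm, ← ContinuousLinearMap.sSup_unitClosedBall_eq_norm]
    refine csSup_le ⟨_, 0, by simp, rfl⟩ ?_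
    rintro _ ⟨w, hw, rfl⟩
    exact hmax hw

theorem exists_eq_hermitian {a : Matrix (Fin 2) (Fin 2) 𝔽} (ha : aᴴ = a) :
    ∃ (p s : ℝ) (q : 𝔽), a = hermitian p s q := by
  have entry (i j : Fin 2) : star (a j i) = a i j := congrFun (congrFun ha i) j
  obtain ⟨p, hp⟩ := exists_of_star_eq _ (entry 0 0)
  obtain ⟨s, hs⟩ := exists_of_star_eq _ (entry 1 1)
  refine ⟨p, s, a 0 1, ?_⟩
  rw [hermitian, ← hp, ← hs, entry 1 0]
  exact eta_fin_two a

theorem exists_eq_hermitian_neg {b : Matrix (Fin 2) (Fin 2) 𝔽} (hb : bᴴ = b)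
    (htr : trace b = 0) : ∃ (d : ℝ) (q : 𝔽), b = hermitian d (-d) q := by
  obtain ⟨p, s, q, rfl⟩ := exists_eq_hermitian hb
  rw [trace_hermitian, FaithfulSMul.algebraMap_eq_zero_iff] at htr
  exact ⟨p, q, by rw [eq_neg_of_add_eq_zero_right htr]⟩

theorem conjTranspose_hermitian (p s : ℝ) (q : 𝔽) :
    (hermitian p s q)ᴴ = hermitian p s q := by
  ext i j
  fin_cases i <;> fin_cases j <;> simp [hermitian, star_algebraMap]

theorem hermitian_neg_mul_self (d : ℝ) (q : 𝔽) :
    hermitian d (-d) q * hermitian d (-d) q =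
      algebraMap ℝ 𝔽 (d ^ 2 + ‖q‖ ^ 2) • (1 : Matrix (Fin 2) (Fin 2) 𝔽) := by
  have h := Algebra.commutes d q
  have h' := Algebra.commutes d (star q)
  ext i j
  fin_cases i <;> fin_cases j <;>
    simp [hermitian, mul_apply, Fin.sum_univ_two, star_mul_self_eq, self_mul_star_eq, h, h', sq,
      -map_pow, -map_mul] <;> simp [add_comm]

theorem opN_hermitian_neg (d : ℝ) (q : 𝔽) :
    opN 𝔽 (hermitian d (-d) q) = √(d ^ 2 + ‖q‖ ^ 2) := by
  have hρ : 0 ≤ d ^ 2 + ‖q‖ ^ 2 := by positivity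
  have scale (v : Plane 𝔽) :
      ‖toOp (hermitian d (-d) q) v‖ = √(d ^ 2 + ‖q‖ ^ 2) * ‖v‖ := by
    rw [← pow_left_inj₀ (norm_nonneg _) (by positivity) two_ne_zero, mul_pow, Real.sq_sqrt hρ]
    apply FaithfulSMul.algebraMap_injective ℝ 𝔽
    rw [map_mul, algebraMap_norm_sq_plane, algebraMap_norm_sq_plane, toOp_apply, star_mulVec,
      ← dotProduct_mulVec, mulVec_mulVec, conjTranspose_hermitian, hermitian_neg_mul_self,
      smul_mulVec, one_mulVec, ← Algebra.smul_def, algebraMap_smul, dotProduct_smul]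
  rw [opN_eq_norm]
  refine ContinuousLinearMap.opNorm_eq_of_bounds (Real.sqrt_nonneg _) (fun v => (scale v).le) ?_
  intro C hC h
  have hv : 0 < ‖(WithLp.toLp 2 (fun _ => 1) : Plane 𝔽)‖ := by
    rw [norm_pos_iff]
    intro h0
    simpa using congrArg (fun v : Plane 𝔽 => v 0) h0
  refine le_of_mul_le_mul_right ?_ hv
  rw [← scale]
  exact h _

theorem exists_eigenvector (d : ℝ) (q : 𝔽) {σ : ℝ} (hσ : σ ^ 2 = d ^ 2 + ‖q‖ ^ 2) :
    ∃ v : Plane 𝔽, v ≠ 0 ∧ toOp (hermitian d (-d) q) v = σ • v := by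
  have hq : algebraMap ℝ 𝔽 (‖q‖ ^ 2) = algebraMap ℝ 𝔽 (σ ^ 2 - d ^ 2) := by
    rw [hσ, add_sub_cancel_left]
  by_cases h0 : d + σ = 0
  · obtain rfl : σ = -d := by linarith
    have hq0 : q = 0 := by
      have : ‖q‖ ^ 2 = 0 := by linarith [neg_sq d]
      simpa using this
    subst hq0
    refine ⟨!₂[0, 1], fun h => by simpa using congrArg (fun v : Plane 𝔽 => v 1) h, ?_⟩
    ext i
    fin_cases i <;> simp [toOp_apply, hermitian, Algebra.smul_def]
  · refine ⟨!₂[algebraMap ℝ 𝔽 (d + σ), star q], fun h => h0 ?_, ?_⟩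
    · simpa [-map_add] using congrArg (fun v : Plane 𝔽 => v 0) h
    · ext i
      fin_cases i
      · simp [toOp_apply, hermitian, -map_add, -map_sub, self_mul_star_eq, -map_pow, hq,
          Algebra.smul_def]
        simp only [← map_mul, ← map_add]
        ring_nf
      · simp [toOp_apply, hermitian, Algebra.smul_def, mul_add, Algebra.commutes _ (star q)]

theorem opN_hermitian (p s : ℝ) (q : 𝔽) :
    opN 𝔽 (hermitian p s q) = ‖trace (hermitian p s q)‖ / 2 +
      opN 𝔽 (hermitian p s q - (trace (hermitian p s q) / 2) • 1) := by
  have hsplit := hermitian_eq_add p s q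
  rw [sub_eq_of_eq_add' hsplit, opN_hermitian_neg]
  have hnorm : ‖trace (hermitian p s q)‖ / 2 = |(p + s) / 2| := by
    rw [trace_hermitian, norm_algebraMap', Real.norm_eq_abs, abs_div, abs_two]
  rw [hnorm]
  rw [half_trace_hermitian] at hsplit
  set d := (p - s) / 2
  set τ := (p + s) / 2
  set ρ := √(d ^ 2 + ‖q‖ ^ 2) with hρ
  have hρ0 : 0 ≤ ρ := Real.sqrt_nonneg _
  have hρsq : ρ ^ 2 = d ^ 2 + ‖q‖ ^ 2 := Real.sq_sqrt (by positivity)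
  have hop : toOp (hermitian p s q) =
      τ • ContinuousLinearMap.id ℝ (Plane 𝔽) + toOp (hermitian d (-d) q) := by
    rw [hsplit, toOp_add, toOp_algebraMap_smul_one]
  apply le_antisymm
  · rw [hρ, ← opN_hermitian_neg, opN_eq_norm, opN_eq_norm, hop]
    refine (norm_add_le (τ • ContinuousLinearMap.id ℝ (Plane 𝔽)) _).trans ?_
    gcongr
    refine (ContinuousLinearMap.opNorm_smul_le _ _).trans ?_
    rw [Real.norm_eq_abs]
    exact mul_le_of_le_one_right (abs_nonneg _) ContinuousLinearMap.norm_id_le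
  · obtain ⟨σ, hσ, habs⟩ : ∃ σ : ℝ, σ ^ 2 = d ^ 2 + ‖q‖ ^ 2 ∧ |τ| + ρ = |τ + σ| := by
      rcases le_total 0 τ with hτ | hτ
      · exact ⟨ρ, hρsq, by rw [abs_of_nonneg hτ, abs_of_nonneg (add_nonneg hτ hρ0)]⟩
      · refine ⟨-ρ, by rw [neg_sq, hρsq], ?_⟩
        rw [abs_of_nonpos hτ, abs_of_nonpos (by linarith)]
        ring
    obtain ⟨v, hv, hev⟩ := exists_eigenvector d q hσ
    have hav : toOp (hermitian p s q) v = (τ + σ) • v := by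
      rw [hop, _root_.add_apply, hev, add_smul]
      rfl
    refine le_of_mul_le_mul_right ?_ (norm_pos_iff.mpr hv)
    rw [habs, ← Real.norm_eq_abs, ← norm_smul, ← hav, opN_eq_norm]
    exact (toOp _).le_opNorm v

theorem norm_trace_hermitian_neg (d : ℝ) (q : 𝔽) :
    ‖trace ((hermitian d (-d) q)ᴴ * hermitian d (-d) q)‖ / 2 = d ^ 2 + ‖q‖ ^ 2 := by
  rw [conjTranspose_hermitian, hermitian_neg_mul_self, trace_smul, trace_one, smul_eq_mul,
    norm_mul, norm_algebraMap', Real.norm_eq_abs, abs_of_nonneg (by positivity), Fintype.card_fin,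
    ← map_natCast (algebraMap ℝ 𝔽), norm_algebraMap']
  simp

theorem fixed_of_norm_add_eq_two {v w : Plane 𝔽} (hv : ‖v‖ ≤ 1) (hw : ‖w‖ ≤ 1)
    (h : ‖v + w‖ = 2) : v = w ∧ ‖v‖ = 1 := by
  have hp := parallelogram_plane v w
  have hv2 : ‖v‖ ^ 2 ≤ 1 := (sq_le_one_iff₀ (norm_nonneg _)).mpr hv
  have hw2 : ‖w‖ ^ 2 ≤ 1 := (sq_le_one_iff₀ (norm_nonneg _)).mpr hw
  rw [h] at hp
  have h0 : ‖v - w‖ ^ 2 = 0 := le_antisymm (by linarith) (sq_nonneg _)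
  refine ⟨sub_eq_zero.mp (norm_eq_zero.mp (pow_eq_zero_iff two_ne_zero |>.mp h0)), ?_⟩
  have := norm_add_le v w
  linarith

/-- Fixed and anti-fixed vectors of a contraction are orthogonal. -/
theorem dotProduct_eq_zero_of_contraction {x : Matrix (Fin 2) (Fin 2) 𝔽} (hx : opN 𝔽 x ≤ 1)
    {v w : Plane 𝔽} (hv : toOp x v = v) (hw : toOp x w = -w) :
    star v.ofLp ⬝ᵥ w.ofLp = 0 := by
  set c := star v.ofLp ⬝ᵥ w.ofLp with hc
  set u : Plane 𝔽 := WithLp.toLp 2 (MulOpposite.op (star c) • w.ofLp) with hu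
  have hxu : toOp x u = -u := by
    have hw' : x *ᵥ w.ofLp = -w.ofLp := congrArg WithLp.ofLp hw
    rw [toOp_apply, hu, mulVec_smul, hw', smul_neg, WithLp.toLp_neg]
  have hle : ‖v + u‖ ≤ ‖v - u‖ := by
    have h := (toOp x).le_of_opNorm_le (opN_eq_norm x ▸ hx) (v - u)
    rwa [map_sub, hv, hxu, sub_neg_eq_add, one_mul] at h
  have hexp : ‖v + u‖ ^ 2 = ‖v - u‖ ^ 2 + 4 * ‖c‖ ^ 2 := by
    apply FaithfulSMul.algebraMap_injective ℝ 𝔽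
    rw [map_add, map_mul, map_ofNat, algebraMap_norm_sq_plane, algebraMap_norm_sq_plane,
      ← self_mul_star_eq]
    have huv : star u.ofLp ⬝ᵥ v.ofLp = c * star c := by
      simp [hu, hc, dotProduct, Fin.sum_univ_two, mul_add, add_mul, mul_assoc]
    have hvu : star v.ofLp ⬝ᵥ u.ofLp = c * star c := by
      simp [hu, hc, dotProduct, Fin.sum_univ_two, add_mul, mul_assoc]
    simp only [WithLp.ofLp_add, WithLp.ofLp_sub, star_add, star_sub, add_dotProduct,
      sub_dotProduct, dotProduct_add, dotProduct_sub, huv, hvu]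
    noncomm_ring
  have hsq := pow_le_pow_left₀ (norm_nonneg _) hle 2
  have hc0 : ‖c‖ ^ 2 = 0 := le_antisymm (by linarith) (sq_nonneg _)
  simpa using hc0

/-- A contraction with a unit fixed vector and a unit anti-fixed vector is a traceless
self-adjoint matrix. -/
theorem traceless_selfAdjoint_of_contraction {x : Matrix (Fin 2) (Fin 2) 𝔽} (hx : opN 𝔽 x ≤ 1)
    {v w : Plane 𝔽} (hv : toOp x v = v) (hw : toOp x w = -w) (hv1 : ‖v‖ = 1) (hw1 : ‖w‖ = 1) :
    xᴴ = x ∧ trace x = 0 := by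
  have hvw := dotProduct_eq_zero_of_contraction hx hv hw
  have hwv : star w.ofLp ⬝ᵥ v.ofLp = 0 := by
    rw [← star_star (star w.ofLp ⬝ᵥ v.ofLp), star_dotProduct, star_star, hvw, star_zero]
  have hvv : star v.ofLp ⬝ᵥ v.ofLp = 1 := by
    rw [← algebraMap_norm_sq_plane, hv1, one_pow, map_one]
  have hww : star w.ofLp ⬝ᵥ w.ofLp = 1 := by
    rw [← algebraMap_norm_sq_plane, hw1, one_pow, map_one]
  have hxv : x *ᵥ v.ofLp = v.ofLp := congrArg WithLp.ofLp hv
  have hxw : x *ᵥ w.ofLp = -w.ofLp := congrArg WithLp.ofLp hw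
  set U : Matrix (Fin 2) (Fin 2) 𝔽 := (of ![v.ofLp, w.ofLp])ᵀ with hU
  have hUU : Uᴴ * U = 1 := by
    ext i j
    fin_cases i <;> fin_cases j
    · exact hvv
    · exact hvw
    · exact hwv
    · exact hww
  have hUU' : U * Uᴴ = 1 := mul_eq_one_comm.mp hUU
  have hxU : x * U = U * diagonal ![1, -1] := by
    ext i j
    rw [mul_diagonal]
    fin_cases j
    · refine (congrFun hxv i).trans ?_
      simp [hU]
    · refine (congrFun hxw i).trans ?_
      simp [hU]
  have hxe : x = U * diagonal ![1, -1] * Uᴴ := by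
    rw [← hxU, mul_assoc, hUU', mul_one]
  constructor
  · rw [hxe, conjTranspose_mul, conjTranspose_mul, conjTranspose_conjTranspose,
      diagonal_conjTranspose, mul_assoc]
    congr 3
    ext i
    fin_cases i <;> simp
  · have htr : trace x = algebraMap ℝ 𝔽 (‖v‖ ^ 2 - ‖w‖ ^ 2) := by
      rw [hxe, norm_sq_plane, norm_sq_plane]
      simp only [map_sub, map_add, ← self_mul_star_eq]
      simp [hU, trace_fin_two, mul_apply, Fin.sum_univ_two]
      abel
    rw [htr, hv1, hw1, sub_self, map_zero]

theorem traceless_selfAdjoint_of_opN {x : Matrix (Fin 2) (Fin 2) 𝔽} (hx : opN 𝔽 x = 1)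
    (hadd : opN 𝔽 (1 + x) = 2) (hsub : opN 𝔽 (1 - x) = 2) : xᴴ = x ∧ trace x = 0 := by
  have contr (u : Plane 𝔽) (hu : ‖u‖ ≤ 1) : ‖toOp x u‖ ≤ 1 := by
    simpa [← opN_eq_norm, hx] using (toOp x).le_opNorm_of_le hu
  obtain ⟨v, hv, hv2⟩ := exists_norm_toOp_eq (1 + x)
  obtain ⟨w, hw, hw2⟩ := exists_norm_toOp_eq (1 - x)
  rw [hadd, toOp_add, toOp_one] at hv2
  rw [hsub, toOp_sub, toOp_one, sub_eq_add_neg] at hw2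
  obtain ⟨hxv, hv1⟩ := fixed_of_norm_add_eq_two hv (contr v hv) hv2
  obtain ⟨hxw, hw1⟩ := fixed_of_norm_add_eq_two (w := -toOp x w) hw
    (by rw [norm_neg]; exact contr w hw) hw2
  exact traceless_selfAdjoint_of_contraction hx.le hxv.symm (neg_eq_iff_eq_neg.mp hxw.symm) hv1 hw1

theorem tracelessSelfAdjointL1Decomposition (𝔽 : Type*) [NormedDivisionRing 𝔽] [StarRing 𝔽]
    [NormedAlgebra ℝ 𝔽] [RealStarDivisionAlgebra 𝔽] :
    TracelessSelfAdjointL1Decomposition 𝔽 := by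
  refine ⟨fun b hb htr => ?_, fun b c hb htb hc htc => ?_, fun a ha => ?_,
    fun x hx hadd hsub => traceless_selfAdjoint_of_opN hx hadd hsub⟩
  · obtain ⟨d, q, rfl⟩ := exists_eq_hermitian_neg hb htr
    rw [norm_trace_hermitian_neg, opN_hermitian_neg]
  · obtain ⟨d, q, rfl⟩ := exists_eq_hermitian_neg hb htb
    obtain ⟨e, r, rfl⟩ := exists_eq_hermitian_neg hc htc
    have hadd : hermitian d (-d) q + hermitian e (-e) r =
        hermitian (d + e) (-(d + e)) (q + r) := by
      ext i j
      fin_cases i <;> fin_cases j <;> simp [hermitian, add_comm]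
    have hsub : hermitian d (-d) q - hermitian e (-e) r =
        hermitian (d - e) (-(d - e)) (q - r) := by
      ext i j
      fin_cases i <;> fin_cases j <;> simp [hermitian, neg_add_eq_sub]
    have hsq (d : ℝ) (q : 𝔽) : √(d ^ 2 + ‖q‖ ^ 2) ^ 2 = d ^ 2 + ‖q‖ ^ 2 :=
      Real.sq_sqrt (by positivity)
    rw [hadd, hsub]
    simp only [opN_hermitian_neg, hsq]
    linarith [parallelogram q r]
  · obtain ⟨p, s, q, rfl⟩ := exists_eq_hermitian ha
    exact opN_hermitian p s q

end RealStarDivisionAlgebra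

/-- For `A = M₂(𝔽)` with `𝔽 ∈ {ℝ, ℂ, ℍ}` and the operator norm: the traceless self-adjoint
part `H` is a real Hilbert space with norm `tr(b* b) ^ (1/2)`, the self-adjoint part of `A`
is isometrically `ℝ ⊕₁ H` via `a ↦ (tr a, a - (tr a) • 1)` where `tr` is the normalized
trace, and every `x ∈ S_A` with `‖1 + x‖ = 2 = ‖1 - x‖` lies in `H`. -/
theorem m2_selfAdjoint_l1_decomposition :
    TracelessSelfAdjointL1Decomposition ℝ ∧
    TracelessSelfAdjointL1Decomposition ℂ ∧
    TracelessSelfAdjointL1Decomposition (Quaternion ℝ) := by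
  exact ⟨RealStarDivisionAlgebra.tracelessSelfAdjointL1Decomposition ℝ,
    RealStarDivisionAlgebra.tracelessSelfAdjointL1Decomposition ℂ,
    RealStarDivisionAlgebra.tracelessSelfAdjointL1Decomposition (Quaternion ℝ)⟩
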